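/- Let ℓ, m be natural numbers with ℓ > 1, set n := ℓ·m, and let K be a field whose characteristic does not divide the integer ELS(m) − OLS(m). Then there exists an online algorithm that sequentially takes m+1 bases of K^n as input and, immediately after reading the i-th basis, arranges it as the i-th row of an (m+1) × n array, such that in the resulting array every column consists of m+1 linearly independent vectors. Precisely: there exist functions s_1,…,s_{m+1}, where s_i maps an i × n array of vectors of K^n to a permutation of {1,…,n}, such that for every (m+1) × n array (v_{ij}) of vectors in K^n whose rows are bases of K^n, setting π_i := s_i(v_{1•},…,v_{i•}), for each j = 1,…,n the vectors v_{1,π_1(j)}, …, v_{m+1,π_{m+1}(j)} are linearly independent. -/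

import Mathlib

/-- The signed count `ELS(m) − OLS(m)` of Latin squares of order `m`.
A Latin square is encoded as a pair `p = (r, c)` where `r i` is the permutation
given by the `i`-th row and `c j` is the permutation given by the `j`-th column;
the compatibility condition `c j i = r i j` says that `r` and `c` come from one
and the same square array whose rows and columns are all permutations.
Each such square contributes its sign. -/
def latinSquareSignedCount (m : ℕ) : ℤ :=
  ∑ p ∈ Finset.univ.filter
      (fun p : (Fin m → Equiv.Perm (Fin m)) × (Fin m → Equiv.Perm (Fin m)) =>
        ∀ i j, p.2 j i = p.1 i j),
    (((∏ i, Equiv.Perm.sign (p.1 i)) * ∏ j, Equiv.Perm.sign (p.2 j) : ℤˣ) : ℤ)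

open Finset in
theorem strat_step {R A : Type*} [Inhabited A] {m : ℕ} (Q : R → Prop)
    (P : (Fin (m + 1) → R) → (Fin (m + 1) → A) → Prop)
    (h : ∀ x, Q x → ∃ a : A, ∃ s : (i : Fin m) → (Fin ((i : ℕ) + 1) → R) → A,
      ∀ v : Fin m → R, (∀ i, Q (v i)) →
        P (Fin.cons x v) (Fin.cons a (fun i => s i (fun k => v (Fin.castLE i.isLt k))))) :
    ∃ s : (i : Fin (m + 1)) → (Fin ((i : ℕ) + 1) → R) → A,
      ∀ v : Fin (m + 1) → R, (∀ i, Q (v i)) →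
        P v (fun i => s i (fun k => v (Fin.castLE i.isLt k))) := by
  classical
  have h' : ∀ x, ∃ a : A, ∃ s : (i : Fin m) → (Fin ((i : ℕ) + 1) → R) → A, Q x →
      ∀ v : Fin m → R, (∀ i, Q (v i)) →
        P (Fin.cons x v) (Fin.cons a (fun i => s i (fun k => v (Fin.castLE i.isLt k)))) := by
    intro x
    by_cases hx : Q x
    · obtain ⟨a, s, hs⟩ := h x hx
      exact ⟨a, s, fun _ => hs⟩
    · exact ⟨default, fun _ _ => default, fun hx' => absurd hx' hx⟩
  choose a s hs using h'
  refine ⟨fun i => Fin.cases (motive := fun i : Fin (m + 1) => (Fin ((i : ℕ) + 1) → R) → A)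
    (fun w => a (w 0)) (fun i w => s (w 0) i (fun k => w k.succ)) i, ?_⟩
  intro v hv
  have := hs (v 0) (hv 0) (fun i => v i.succ) (fun i => hv _)
  convert this using 1
  · exact (Fin.cons_self_tail v).symm
  · funext i
    refine Fin.cases ?_ (fun i => ?_) i
    · rfl
    · rfl

theorem game {K V ι : Type*} [Field K] [AddCommGroup V] [Module K V] [Fintype ι] [DecidableEq ι]
    (B : Module.Basis ι K V) (m : ℕ) (G : (Fin m → ι → V) → K)
    (hG : ∀ (y : Fin m → ι → V) (i : Fin m), ∃ f : MultilinearMap K (fun _ : ι => V) K,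
      ∀ x, G (Function.update y i x) = f x)
    (hc : ∑ σ : Fin m → Equiv.Perm ι,
      (∏ i, ((Equiv.Perm.sign (σ i) : ℤ) : K)) * G (fun i j => B (σ i j)) ≠ 0) :
    ∃ s : (i : Fin m) → (Fin ((i : ℕ) + 1) → (ι → V)) → Equiv.Perm ι,
      ∀ v : Fin m → ι → V, (∀ i, LinearIndependent K (v i) ∧
          Submodule.span K (Set.range (v i)) = ⊤) →
        G (fun i j => v i (s i (fun k => v (Fin.castLE i.isLt k)) j)) ≠ 0 := by
  induction m with
  | zero =>
    refine ⟨fun i => i.elim0, fun v _ => ?_⟩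
    simp only [Fintype.sum_unique, Finset.univ_eq_empty, Finset.prod_empty, one_mul] at hc
    convert hc using 2
  | succ m ih =>
    refine strat_step (fun x : ι → V => LinearIndependent K x ∧
          Submodule.span K (Set.range x) = ⊤)
      (fun v (a : Fin (m + 1) → Equiv.Perm ι) => G (fun i j => v i (a i j)) ≠ 0) ?_
    rintro x ⟨hx1, hx2⟩
    choose f hf using fun σ : Fin m → Equiv.Perm ι =>
      hG (Fin.cons (fun _ => 0) (fun i j => B (σ i j))) 0
    simp only [Fin.update_cons_zero] at hf
    let F : MultilinearMap K (fun _ : ι => V) K :=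
      ∑ σ : Fin m → Equiv.Perm ι, (∏ i, ((Equiv.Perm.sign (σ i) : ℤ) : K)) • f σ
    have hF : ∀ x, F x = ∑ σ : Fin m → Equiv.Perm ι,
        (∏ i, ((Equiv.Perm.sign (σ i) : ℤ) : K)) * G (Fin.cons x (fun i j => B (σ i j))) := by
      intro x
      simp [F, hf]
    have hA : ∀ x : ι → V, MultilinearMap.alternatization F x =
        ∑ σ : Equiv.Perm ι, ((Equiv.Perm.sign σ : ℤ) : K) * F (fun j => x (σ j)) := by
      intro x
      simp [MultilinearMap.alternatization_apply, Units.smul_def]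
    have hB : MultilinearMap.alternatization F B ≠ 0 := by
      rw [hA]
      convert hc using 1
      rw [← (Fin.consEquiv (fun _ => Equiv.Perm ι)).sum_comp, Fintype.sum_prod_type]
      refine Finset.sum_congr rfl fun σ _ => ?_
      rw [hF, Finset.mul_sum]
      refine Finset.sum_congr rfl fun τ _ => ?_
      rw [Fin.prod_univ_succ, ← mul_assoc]
      simp only [Fin.consEquiv, Equiv.coe_fn_mk, Fin.cons_zero, Fin.cons_succ]
      congr 2
      funext i
      refine Fin.cases ?_ (fun i => ?_) i <;> rfl
    have hX : MultilinearMap.alternatization F x ≠ 0 := by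
      have h0 : MultilinearMap.alternatization F ≠ 0 := by
        intro h; rw [h] at hB; exact hB rfl
      have := (AlternatingMap.map_basis_ne_zero_iff (Module.Basis.mk hx1 hx2.ge)
        (MultilinearMap.alternatization F)).2 h0
      simpa using this
    rw [hA] at hX
    obtain ⟨σ, -, hσ⟩ := Finset.exists_ne_zero_of_sum_ne_zero hX
    have hσ' := right_ne_zero_of_mul hσ
    rw [hF] at hσ'
    obtain ⟨s, hs⟩ := ih (fun y => G (Fin.cons (fun j => x (σ j)) y)) (by
      intro y i
      obtain ⟨f, hf⟩ := hG (Fin.cons (fun j => x (σ j)) y) i.succ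
      refine ⟨f, fun z => ?_⟩
      rw [← hf, Fin.cons_update]) hσ'
    refine ⟨σ, s, fun v hv => ?_⟩
    convert hs v hv using 2
    funext i
    refine Fin.cases ?_ (fun i => ?_) i <;> rfl

theorem latin_sum (m : ℕ) (K : Type*) [Field K] :
    ∑ ρ : Fin m → Equiv.Perm (Fin m), (∏ i, ((Equiv.Perm.sign (ρ i) : ℤ) : K)) *
      ∏ s, (Matrix.of fun i t : Fin m => if ρ i s = t then (1 : K) else 0).det =
    ((latinSquareSignedCount m : ℤ) : K) := by
  have h1 : ∀ (ρ : Fin m → Equiv.Perm (Fin m)) (s : Fin m),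
      (Matrix.of fun i t : Fin m => if ρ i s = t then (1 : K) else 0).det =
      ∑ κ : Equiv.Perm (Fin m), if ∀ i, κ i = ρ i s then ((Equiv.Perm.sign κ : ℤ) : K) else 0 := by
    intro ρ s
    rw [← Matrix.det_transpose, Matrix.det_apply']
    refine Finset.sum_congr rfl fun κ _ => ?_
    simp only [Matrix.transpose_apply, Matrix.of_apply]
    rw [Finset.prod_ite_zero]
    simp [eq_comm]
  simp only [h1, Finset.prod_univ_sum, Fintype.piFinset_univ, Finset.prod_ite_zero]
  rw [latinSquareSignedCount, Finset.sum_filter, Fintype.sum_prod_type]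
  push_cast
  refine Finset.sum_congr rfl fun ρ _ => ?_
  rw [Finset.mul_sum]
  refine Finset.sum_congr rfl fun c _ => ?_
  have : (∀ i ∈ Finset.univ, ∀ k, (c i) k = (ρ k) i) ↔ ∀ i j, c j i = ρ i j :=
    ⟨fun h i j => h j (Finset.mem_univ _) i, fun h i _ k => h k i⟩
  by_cases h : ∀ i j, c j i = ρ i j
  · rw [if_pos (this.2 h), if_pos h]
  · rw [if_neg (fun h' => h (this.1 h')), if_neg h]; simp

theorem block_sum (ℓ m : ℕ) (K : Type*) [Field K] :
    ∑ τ : Fin m → Equiv.Perm (Fin ℓ × Fin m), (∏ i, ((Equiv.Perm.sign (τ i) : ℤ) : K)) *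
      ∏ j : Fin ℓ × Fin m,
        (Matrix.of fun i t : Fin m => if τ i j = (j.1, t) then (1 : K) else 0).det =
    ((latinSquareSignedCount m : ℤ) : K) ^ ℓ := by
  have hpow : ((latinSquareSignedCount m : ℤ) : K) ^ ℓ =
      ∏ _b : Fin ℓ, ((latinSquareSignedCount m : ℤ) : K) := by simp
  rw [hpow, ← latin_sum, Finset.prod_univ_sum, Fintype.piFinset_univ]
  symm
  refine Fintype.sum_of_injective
    (fun (ρ : Fin ℓ → Fin m → Equiv.Perm (Fin m)) i => Equiv.prodCongrRight (fun b => ρ b i))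
    ?_ _ _ ?_ ?_
  · intro ρ ρ' h
    funext b i
    ext s
    have := congrArg (fun q => ((q i) (b, s)).2) h
    simpa using congrArg Fin.val this
  · intro τ hτ
    by_contra hne
    apply hτ
    have hdet := right_ne_zero_of_mul hne
    rw [Finset.prod_ne_zero_iff] at hdet
    have hb : ∀ i b s, (τ i (b, s)).1 = b := by
      intro i b s
      by_contra hh
      refine hdet (b, s) (Finset.mem_univ _) (Matrix.det_eq_zero_of_row_eq_zero i fun t => ?_)
      simp only [Matrix.of_apply]
      rw [if_neg]
      intro h
      exact hh (by rw [h])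
    have hinj : ∀ b i, Function.Injective (fun s => (τ i (b, s)).2) := by
      intro b i s s' h
      have : τ i (b, s) = τ i (b, s') := Prod.ext (by rw [hb, hb]) h
      simpa using (τ i).injective this
    refine ⟨fun b i => Equiv.ofBijective _ (Finite.injective_iff_bijective.1 (hinj b i)), ?_⟩
    funext i
    ext1 ⟨b, s⟩
    exact Prod.ext (hb i b s).symm rfl
  · intro ρ
    simp only [Equiv.Perm.sign_prodCongrRight]
    push_cast
    rw [Finset.prod_mul_distrib, Finset.prod_comm, Fintype.prod_prod_type]
    simp

/-- If `ℓ > 1`, `n = ℓ·m`, and the characteristic of `K` does not divide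
`ELS(m) − OLS(m)`, then there is an online algorithm which, given `m + 1`
bases of `K^n` sequentially, immediately arranges each incoming basis as the
next row of an `(m+1) × n` array so that every column of the resulting array
consists of `m + 1` linearly independent vectors.  The strategy `s i` sees
only rows `0, …, i` (in `Fin`-indexing) and outputs the permutation to be
applied to row `i`. -/
theorem online_independent_columns_of_latin_signed_count_ne_zero
    (ℓ m n : ℕ) (hℓ : 1 < ℓ) (hn : n = ℓ * m) (K : Type*) [Field K]
    (hchar : ((latinSquareSignedCount m : ℤ) : K) ≠ 0) :
    ∃ s : (i : Fin (m + 1)) → (Fin ((i : ℕ) + 1) → Fin n → (Fin n → K)) →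
        Equiv.Perm (Fin n),
      ∀ v : Fin (m + 1) → Fin n → (Fin n → K),
        (∀ i, LinearIndependent K (v i) ∧
          Submodule.span K (Set.range (v i)) = ⊤) →
        ∀ j, LinearIndependent K
          (fun i : Fin (m + 1) =>
            v i (s i (fun k => v (Fin.castLE i.isLt k)) j)) := by
  classical
  have hn' : ℓ * m = n := hn.symm
  let e : Fin n ≃ Fin ℓ × Fin m := (finCongr hn).trans finProdFinEquiv.symm
  obtain ⟨p, hp⟩ : ∃ p : Equiv.Perm (Fin n), ∀ j, (e (p.symm j)).1 ≠ (e j).1 := by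
    obtain ⟨k, rfl⟩ : ∃ k, ℓ = k + 2 := ⟨ℓ - 2, by omega⟩
    refine ⟨(e.trans ((Equiv.addRight (1 : Fin (k + 2))).prodCongr (Equiv.refl _))).trans e.symm,
      fun j => ?_⟩
    obtain ⟨⟨b, t⟩, rfl⟩ := e.symm.surjective j
    simp
  refine strat_step (fun x : Fin n → (Fin n → K) => LinearIndependent K x ∧
          Submodule.span K (Set.range x) = ⊤)
      (fun v (a : Fin (m + 1) → Equiv.Perm (Fin n)) => ∀ j, LinearIndependent K (fun i => v i (a i j))) ?_
  rintro x ⟨hx1, hx2⟩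
  let B : Module.Basis (Fin n) K (Fin n → K) := (Module.Basis.mk hx1 hx2.ge).reindex p.symm
  have hB : ∀ j, x j = B (p.symm j) := by
    intro j; simp [B]
  let φ : Fin n → (Fin n → K) →ₗ[K] (Fin m → K) := fun j =>
    LinearMap.pi fun t => B.coord (e.symm ((e j).1, t))
  obtain ⟨s, hs⟩ := game B m
    (fun y => ∏ j, (Matrix.of fun i t : Fin m => φ j (y i j) t).det) (by
      intro y i
      refine ⟨(MultilinearMap.mkPiAlgebra K (Fin n) K).compLinearMap (fun j =>
        ((Matrix.detRowAlternating (R := K) (n := Fin m)).toMultilinearMap.toLinearMap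
          (fun i t => φ j (y i j) t) i) ∘ₗ φ j), fun z => ?_⟩
      simp only [MultilinearMap.compLinearMap_apply, MultilinearMap.mkPiAlgebra_apply]
      refine Finset.prod_congr rfl fun j _ => ?_
      simp only [LinearMap.comp_apply, MultilinearMap.toLinearMap_apply]
      change _ = Matrix.det _
      congr 1
      ext i' t
      by_cases h : i' = i
      · subst h; simp
      · simp [h]) (by
      rw [← (Equiv.piCongrRight (fun _ : Fin m => e.symm.permCongr)).sum_comp]
      have := pow_ne_zero ℓ hchar
      rw [← block_sum] at this
      convert this using 1
      refine Finset.sum_congr rfl fun τ _ => ?_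
      congr 1
      · simp
      · rw [← e.prod_comp]
        refine Finset.prod_congr rfl fun j _ => ?_
        congr 1
        ext i t
        simp [φ, Module.Basis.coord_apply, Finsupp.single_apply])
  refine ⟨1, s, fun v hv j => ?_⟩
  have hd := Finset.prod_ne_zero_iff.1 (hs v hv) j (Finset.mem_univ _)
  have hli := Matrix.linearIndependent_rows_of_det_ne_zero hd
  set u : Fin m → (Fin n → K) :=
    fun i => v i (s i (fun k => v (Fin.castLE i.isLt k)) j) with hu
  have hli' : LinearIndependent K (φ j ∘ u) := hli
  have hcons : (fun i : Fin (m + 1) => (Fin.cons x v : Fin (m + 1) → Fin n → (Fin n → K)) i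
      ((Fin.cons 1 (fun i => s i (fun k => v (Fin.castLE i.isLt k))) :
        Fin (m + 1) → Equiv.Perm (Fin n)) i j)) = Fin.cons (x j) u := by
    funext i
    refine Fin.cases ?_ (fun i => ?_) i <;> rfl
  rw [hcons, linearIndependent_finCons]
  refine ⟨hli'.of_comp, fun hmem => hx1.ne_zero j ?_⟩
  refine Submodule.disjoint_def.1 (Submodule.range_ker_disjoint hli') _ hmem ?_
  rw [LinearMap.mem_ker]
  funext t
  rw [hB]
  simp only [φ, LinearMap.pi_apply, Module.Basis.coord_apply, Module.Basis.repr_self, Pi.zero_apply]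
  rw [Finsupp.single_apply, if_neg]
  intro h
  apply hp j
  rw [h]; simp
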